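/- Fix an integer d ≥ 13, a ∈ (0,1), and λ_∞, c_∞ ∈ ℝ. Suppose Ψ_∞ : ℝ → ℝ is a C² solution of equation (E_{λ_∞}) with Ψ_∞(t) − √(d−3)·(1 − λ_∞ (4d−10)^{-1} e^{2t}) = O(e^{4t}) as t → −∞. Suppose there is C₁ > 0 and, for each (λ,c) in a neighborhood of (λ_∞,c_∞), a C² solution Ψ_{λ,c} : ℝ → ℝ of equation (E_λ) such that |Ψ_{λ,c}(0) − Ψ_∞(0)| + |Ψ_{λ,c}'(0) − Ψ_∞'(0)| ≤ C₁(|λ − λ_∞| + |c − c_∞|). Then there exist constants b₀ > 0, C₀ > 0, and ε₀ > 0 such that for every ε ∈ (0,ε₀), every b > b₀, and every (λ,c) with |λ − λ_∞| + |c − c_∞| ≤ ε b^{κ₋(1−a)}, one has |Ψ_{λ,c}(t) − Ψ_∞(t)| ≤ C₀ ε b^{κ₋(1−a)} e^{κ₋ t} for every t ∈ [(a−1)·log b, 0]. -/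

import Mathlib

open Filter Asymptotics Topology Set

/-- The characteristic exponent `κ₋ = (-(d-4) - √(d²-16d+40))/2`. -/
noncomputable def kappam (d : ℤ) : ℝ :=
  (-((d : ℝ) - 4) - Real.sqrt ((d : ℝ) ^ 2 - 16 * (d : ℝ) + 40)) / 2

set_option maxHeartbeats 1000000 in
lemma aux_core (km kp K A η ε S : ℝ) (w w1 F : ℝ → ℝ)
    (hkm : km ≤ -1) (hkp : km + 1 ≤ kp) (hK : 1 ≤ K) (hA : 1 ≤ A) (hη : 0 < η)
    (hw : ∀ t, HasDerivAt w (w1 t) t)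
    (hw1 : ∀ t, HasDerivAt w1 ((km + kp) * w1 t - km * kp * w t + F t) t)
    (hF : ∀ t ≤ 0, |F t| ≤ K * (Real.exp (2 * t) * η + Real.exp (2 * t) * |w t|
      + |w t| ^ 2 * (1 + |w t|)))
    (h0 : (w1 0 - kp * w 0) ^ 2 + (w1 0 - km * w 0) ^ 2 ≤ (η * A) ^ 2)
    (hε : 16 * K * A * Real.exp (4 * K + 1) * ε ≤ 1)
    (hS : η * Real.exp (-km * S) ≤ ε) :
    ∀ s ∈ Set.Icc 0 S, |w (-s)| ≤ 2 * A * Real.exp (4 * K + 1) * η * Real.exp (-km * s) := by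
  set M := Real.exp (4 * K + 1) with hM
  have hMpos : 0 < M := Real.exp_pos _
  have hM1 : 1 ≤ M := Real.one_le_exp (by linarith)
  set ψ : ℝ → ℝ := fun s => 4 * K * (1 - Real.exp (-2 * s))
    + 16 * K * A * M * (η * Real.exp (-km * s) - η) with hψ
  have hq : ∀ s ∈ Set.Icc 0 S, η * Real.exp (-km * s) ≤ ε := by
    intro s hs
    refine le_trans ?_ hS
    have : -km * s ≤ -km * S := by nlinarith [hs.2]
    gcongr
  have hψub : ∀ s ∈ Set.Icc 0 S, Real.exp (ψ s) ≤ M := by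
    intro s hs
    apply Real.exp_le_exp.mpr
    have h1 := hq s hs
    have h2 : 0 < Real.exp (-2 * s) := Real.exp_pos _
    have h3 : 16 * K * A * M * (η * Real.exp (-km * s) - η) ≤ 16 * K * A * M * ε := by
      apply mul_le_mul_of_nonneg_left (by linarith) (by positivity)
    have h4 : 4 * K * (1 - Real.exp (-2 * s)) ≤ 4 * K := by nlinarith
    simp only [hψ]; linarith
  have hψlb : ∀ s ∈ Set.Icc 0 S, 1 ≤ Real.exp (ψ s) := by
    intro s hs
    apply Real.one_le_exp
    have h1 : Real.exp (-2 * s) ≤ 1 := Real.exp_le_one_iff.mpr (by linarith [hs.1])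
    have h2 : 1 ≤ Real.exp (-km * s) := Real.one_le_exp (by nlinarith [hs.1])
    have h3 : 0 ≤ 16 * K * A * M * (η * Real.exp (-km * s) - η) := by
      apply mul_nonneg (by positivity); nlinarith
    have h4 : 0 ≤ 4 * K * (1 - Real.exp (-2 * s)) := by
      apply mul_nonneg (by positivity); linarith
    simp only [hψ]; linarith
  have hpq : ∀ s, Real.exp (km * s) * Real.exp (-km * s) = 1 := by
    intro s; rw [← Real.exp_add]; simp
  -- bound of w from the barrier
  have hwb : ∀ s R, 0 < R → (Real.exp (km * s) * (w1 (-s) - kp * w (-s))) ^ 2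
      + (Real.exp (km * s) * (w1 (-s) - km * w (-s))) ^ 2 ≤ R ^ 2 →
      Real.exp (km * s) * |w (-s)| ≤ 2 * R := by
    intro s R hR h
    have h1 : |Real.exp (km * s) * (w1 (-s) - kp * w (-s))| ≤ R :=
      abs_le_of_sq_le_sq (by nlinarith [sq_nonneg (Real.exp (km * s) * (w1 (-s) - km * w (-s)))]) hR.le
    have h2 : |Real.exp (km * s) * (w1 (-s) - km * w (-s))| ≤ R :=
      abs_le_of_sq_le_sq (by nlinarith [sq_nonneg (Real.exp (km * s) * (w1 (-s) - kp * w (-s)))]) hR.le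
    have h3 : |(kp - km) * (Real.exp (km * s) * w (-s))| ≤ 2 * R := by
      have : (kp - km) * (Real.exp (km * s) * w (-s)) =
        Real.exp (km * s) * (w1 (-s) - km * w (-s)) - Real.exp (km * s) * (w1 (-s) - kp * w (-s)) := by ring
      rw [this]
      exact (abs_sub _ _).trans (by linarith)
    rw [abs_mul, abs_mul, abs_of_pos (Real.exp_pos _), abs_of_pos (by linarith : 0 < kp - km)] at h3
    have h4 : 0 ≤ Real.exp (km * s) * |w (-s)| := by positivity
    nlinarith
  have key : ∀ ⦃s⦄, s ∈ Set.Icc 0 S → (Real.exp (km * s) * (w1 (-s) - kp * w (-s))) ^ 2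
      + (Real.exp (km * s) * (w1 (-s) - km * w (-s))) ^ 2 ≤ (η * A * Real.exp (ψ s)) ^ 2 := by
    have hwn : ∀ s, HasDerivAt (fun s => w (-s)) (-(w1 (-s))) s := by
      intro s
      have := (hw (-s)).comp s (hasDerivAt_neg s)
      simpa [Function.comp_def] using this
    have hw1n : ∀ s, HasDerivAt (fun s => w1 (-s))
        (-((km + kp) * w1 (-s) - km * kp * w (-s) + F (-s))) s := by
      intro s
      have := (hw1 (-s)).comp s (hasDerivAt_neg s)
      simpa [Function.comp_def] using this
    have hexp : ∀ c s : ℝ, HasDerivAt (fun s => Real.exp (c * s)) (c * Real.exp (c * s)) s := by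
      intro c s
      have := ((hasDerivAt_id s).const_mul c).exp
      simpa [mul_comm] using this
    have hfd : ∀ s, HasDerivAt (fun s => (Real.exp (km * s) * (w1 (-s) - kp * w (-s))) ^ 2
        + (Real.exp (km * s) * (w1 (-s) - km * w (-s))) ^ 2)
        (-2 * (kp - km) * (Real.exp (km * s) * (w1 (-s) - km * w (-s))) ^ 2
          - 2 * (Real.exp (km * s) * (w1 (-s) - kp * w (-s))
            + Real.exp (km * s) * (w1 (-s) - km * w (-s))) * (Real.exp (km * s) * F (-s))) s := by
      intro s
      have := (((hexp km s).mul ((hw1n s).sub ((hwn s).const_mul kp))).pow 2).add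
        (((hexp km s).mul ((hw1n s).sub ((hwn s).const_mul km))).pow 2)
      refine this.congr_deriv ?_
      simp only [Pi.mul_apply, Pi.sub_apply]
      push_cast
      ring
    have hψd : ∀ s, HasDerivAt ψ (8 * K * Real.exp (-2 * s)
        + 16 * K * A * M * (η * (-km * Real.exp (-km * s)))) s := by
      intro s
      have := (((hexp (-2) s).const_sub 1).const_mul (4 * K)).add
        ((((hexp (-km) s).const_mul η).sub_const η).const_mul (16 * K * A * M))
      refine this.congr_deriv ?_
      ring
    have hBd : ∀ s, HasDerivAt (fun s => (η * A * Real.exp (ψ s)) ^ 2)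
        (2 * (η * A * Real.exp (ψ s)) ^ 2 * (8 * K * Real.exp (-2 * s)
        + 16 * K * A * M * (η * (-km * Real.exp (-km * s))))) s := by
      intro s
      have := (((hψd s).exp).const_mul (η * A)).pow 2
      refine this.congr_deriv ?_
      push_cast
      ring
    refine image_le_of_deriv_right_lt_deriv_boundary
      (fun s _ => (hfd s).continuousAt.continuousWithinAt)
      (fun s _ => (hfd s).hasDerivWithinAt) ?_ hBd ?_
    · simpa [hψ] using h0
    · intro s hs heq
      have hs' : s ∈ Set.Icc 0 S := ⟨hs.1, hs.2.le⟩
      have hRpos : 0 < η * A * Real.exp (ψ s) := by positivity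
      have hRub : η * A * Real.exp (ψ s) ≤ A * M * η := by
        have := mul_le_mul_of_nonneg_left (hψub s hs') (by positivity : 0 ≤ η * A)
        linarith
      have hηR : η ≤ η * A * Real.exp (ψ s) := by
        have : 1 ≤ A * Real.exp (ψ s) := one_le_mul_of_one_le_of_one_le hA (hψlb s hs')
        nlinarith
      have hwR := hwb s _ hRpos heq.le
      have hFs := hF (-s) (by linarith [hs.1])
      have hqs := hq s hs'
      have hp1 : Real.exp (km * s) ≤ 1 := Real.exp_le_one_iff.mpr (by nlinarith [hs.1])
      have hpp : 0 < Real.exp (km * s) := Real.exp_pos _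
      have hqp : 0 < Real.exp (-km * s) := Real.exp_pos _
      have hep : 0 < Real.exp (-2 * s) := Real.exp_pos _
      have hpqs := hpq s
      rw [show (2 : ℝ) * -s = -2 * s by ring] at hFs
      generalize η * A * Real.exp (ψ s) = R at *
      generalize hz1 : Real.exp (km * s) * (w1 (-s) - kp * w (-s)) = z1 at *
      generalize hz2 : Real.exp (km * s) * (w1 (-s) - km * w (-s)) = z2 at *
      generalize Real.exp (km * s) = p at *
      generalize Real.exp (-km * s) = q at *
      generalize Real.exp (-2 * s) = e at *
      generalize hf : F (-s) = f at *
      have hx : 0 ≤ |w (-s)| := abs_nonneg _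
      generalize |w (-s)| = x at *
      have hz1b : |z1| ≤ R := abs_le_of_sq_le_sq (by nlinarith [sq_nonneg z2]) hRpos.le
      have hz2b : |z2| ≤ R := abs_le_of_sq_le_sq (by nlinarith [sq_nonneg z1]) hRpos.le
      have hxq : x ≤ 2 * R * q := by
        have : x = p * x * q := by linear_combination (-x) * hpqs
        rw [this]; gcongr
      have hRq : R * q ≤ A * M * (η * q) := by
        have := mul_le_mul_of_nonneg_right hRub hqp.le
        linarith
      have hRq2 : 2 * R * q ≤ 1 := by
        have h1 : A * M * (η * q) ≤ A * M * ε := by gcongr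
        have h2 : 0 ≤ A * M * ε := le_trans (by positivity) h1
        have h3 : A * M * ε * 1 ≤ A * M * ε * K := mul_le_mul_of_nonneg_left hK h2
        linarith
      have hpf : p * |f| ≤ K * R * (3 * e + 8 * (A * M * (η * q))) := by
        have h1 : p * |f| ≤ p * (K * (e * η + e * x + x ^ 2 * (1 + x))) := by gcongr
        have h2 : p * (e * η) ≤ e * R := by
          have : p * (e * η) ≤ 1 * (e * R) := by gcongr
          linarith
        have h3 : p * (e * x) ≤ e * (2 * R) := by
          have : e * (p * x) ≤ e * (2 * R) := by gcongr
          linarith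
        have h4 : p * (x ^ 2 * (1 + x)) ≤ 8 * R * (A * M * (η * q)) := by
          have : (p * x) * (x * (1 + x)) ≤ (2 * R) * ((2 * R * q) * (1 + 1)) := by
            gcongr
            linarith
          have h5 : 8 * R * (R * q) ≤ 8 * R * (A * M * (η * q)) := by gcongr
          linarith
        have h6 : K * (p * (e * η) + p * (e * x) + p * (x ^ 2 * (1 + x)))
          ≤ K * (e * R + e * (2 * R) + 8 * R * (A * M * (η * q))) := by gcongr
        linarith
      have hmain : -2 * (z1 + z2) * (p * f) ≤ 4 * R * (p * |f|) := by
        have h1 : |(z1 + z2) * (p * f)| ≤ (2 * R) * (p * |f|) := by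
          rw [abs_mul, abs_mul, abs_of_pos hpp]
          gcongr
          exact (abs_add_le _ _).trans (by linarith)
        linarith [neg_abs_le ((z1 + z2) * (p * f))]
      have h2 : 4 * R * (p * |f|) ≤ 4 * R * (K * R * (3 * e + 8 * (A * M * (η * q)))) := by gcongr
      have h3 : 0 ≤ (kp - km) * z2 ^ 2 := mul_nonneg (by linarith) (sq_nonneg _)
      have h4 : 0 < K * R ^ 2 * e := by positivity
      have h5 : 0 ≤ (K * R ^ 2 * (A * M * (η * q))) * (-km - 1) :=
        mul_nonneg (by positivity) (by linarith)
      linarith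
  intro s hs
  have h1 := hwb s _ (by positivity) (key hs)
  have h2 := hψub s hs
  have hqp : 0 < Real.exp (-km * s) := Real.exp_pos _
  calc |w (-s)| = Real.exp (km * s) * |w (-s)| * Real.exp (-km * s) := by
        linear_combination (-|w (-s)|) * hpq s
    _ ≤ 2 * (η * A * Real.exp (ψ s)) * Real.exp (-km * s) := by gcongr
    _ ≤ 2 * (η * A * M) * Real.exp (-km * s) := by gcongr
    _ = _ := by ring

lemma aux_bdd (f : ℝ → ℝ) (hf : Continuous f)
    (h : f =O[atBot] fun t : ℝ => Real.exp (2 * t)) :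
    ∃ K : ℝ, 0 ≤ K ∧ ∀ t ≤ 0, |f t| ≤ K * Real.exp (2 * t) := by
  obtain ⟨c, hc⟩ := h.bound
  obtain ⟨T, hT⟩ := eventually_atBot.mp hc
  have hcont : Continuous fun t => f t * Real.exp (-2 * t) := by fun_prop
  obtain ⟨C, hC⟩ := (isCompact_Icc (a := T) (b := (0 : ℝ))).exists_bound_of_continuousOn
    hcont.continuousOn
  refine ⟨max (max c C) 0, le_max_right _ _, fun t ht => ?_⟩
  have hep := Real.exp_pos (2 * t)
  rcases le_total t T with h1 | h1
  · have := hT t h1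
    rw [Real.norm_eq_abs, Real.norm_eq_abs, abs_of_pos hep] at this
    refine this.trans ?_
    gcongr
    exact (le_max_left _ _).trans (le_max_left _ _)
  · have := hC t ⟨h1, ht⟩
    rw [Real.norm_eq_abs, abs_mul, abs_of_pos (Real.exp_pos _)] at this
    have h2 : Real.exp (-2 * t) * Real.exp (2 * t) = 1 := by
      rw [← Real.exp_add]; simp
    calc |f t| = |f t| * Real.exp (-2 * t) * Real.exp (2 * t) := by
          linear_combination (-|f t|) * h2
      _ ≤ C * Real.exp (2 * t) := by gcongr
      _ ≤ _ := by
        gcongr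
        exact (le_max_right _ _).trans (le_max_left _ _)

set_option maxHeartbeats 2000000 in
/-- Proposition 2.2 (Proposition `lemma:Psi_c_neg_t` in the paper): closeness of the
solution family `Ψ_{λ,c}` to the limiting singular solution `Ψ_∞` on `[(a-1)log b, 0]`. -/
theorem stmt_1 (d : ℤ) (hd : 13 ≤ d) (a : ℝ) (ha : a ∈ Set.Ioo (0 : ℝ) 1)
    (lamInf cInf : ℝ) (ΨInf : ℝ → ℝ) (Ψ : ℝ → ℝ → ℝ → ℝ)
    (hΨInfC : ContDiff ℝ 2 ΨInf)
    (hΨInfEq : ∀ t : ℝ, deriv (deriv ΨInf) t + ((d : ℝ) - 4) * deriv ΨInf t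
      + (3 - (d : ℝ)) * ΨInf t + (ΨInf t) ^ 3
      = -lamInf * Real.exp (2 * t) * ΨInf t + Real.exp (4 * t) * ΨInf t)
    (hΨInfAsym : (fun t : ℝ => ΨInf t
        - Real.sqrt ((d : ℝ) - 3) * (1 - lamInf * (4 * (d : ℝ) - 10)⁻¹ * Real.exp (2 * t)))
      =O[atBot] fun t : ℝ => Real.exp (4 * t))
    (U : Set (ℝ × ℝ)) (hU : U ∈ 𝓝 ((lamInf, cInf) : ℝ × ℝ))
    (C₁ : ℝ) (hC₁ : 0 < C₁)
    (hfam : ∀ p ∈ U,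
      ContDiff ℝ 2 (Ψ p.1 p.2) ∧
      (∀ t : ℝ, deriv (deriv (Ψ p.1 p.2)) t + ((d : ℝ) - 4) * deriv (Ψ p.1 p.2) t
        + (3 - (d : ℝ)) * Ψ p.1 p.2 t + (Ψ p.1 p.2 t) ^ 3
        = -p.1 * Real.exp (2 * t) * Ψ p.1 p.2 t + Real.exp (4 * t) * Ψ p.1 p.2 t) ∧
      |Ψ p.1 p.2 0 - ΨInf 0| + |deriv (Ψ p.1 p.2) 0 - deriv ΨInf 0|
        ≤ C₁ * (|p.1 - lamInf| + |p.2 - cInf|)) :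
    ∃ b₀ > (0 : ℝ), ∃ C₀ > (0 : ℝ), ∃ ε₀ > (0 : ℝ), ∀ ε ∈ Set.Ioo (0 : ℝ) ε₀,
      ∀ b > b₀, ∀ lam c : ℝ,
        |lam - lamInf| + |c - cInf| ≤ ε * b ^ (kappam d * (1 - a)) →
        ∀ t ∈ Set.Icc ((a - 1) * Real.log b) (0 : ℝ),
          |Ψ lam c t - ΨInf t|
            ≤ C₀ * ε * b ^ (kappam d * (1 - a)) * Real.exp (kappam d * t) := by
  obtain ⟨ha0, ha1⟩ := ha
  have hdR : (13 : ℝ) ≤ d := by exact_mod_cast hd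
  -- exponents
  set D := Real.sqrt ((d : ℝ) ^ 2 - 16 * (d : ℝ) + 40) with hD
  have hD2 : D ^ 2 = (d : ℝ) ^ 2 - 16 * (d : ℝ) + 40 := Real.sq_sqrt (by nlinarith)
  have hD1 : 1 ≤ D := Real.one_le_sqrt.mpr (by nlinarith)
  set km := kappam d with hkmdef
  have hkm : km = (-((d : ℝ) - 4) - D) / 2 := rfl
  obtain ⟨kp, hkp⟩ : ∃ kp, kp = (-((d : ℝ) - 4) + D) / 2 := ⟨_, rfl⟩
  have hsum : km + kp = -((d : ℝ) - 4) := by rw [hkm, hkp]; ring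
  have hprod : km * kp = 2 * ((d : ℝ) - 3) := by
    rw [hkm, hkp]; linear_combination (-1 / 4) * hD2
  have hkm1 : km ≤ -1 := by rw [hkm]; linarith
  have hkpm : km + 1 ≤ kp := by rw [hkm, hkp]; linarith
  have hkp0 : kp ≤ 0 := by
    by_contra hcon
    have : km * kp < 0 := mul_neg_of_neg_of_pos (by linarith) (by linarith)
    linarith
  -- bounds of the limiting profile
  set σ := Real.sqrt ((d : ℝ) - 3) with hσ
  have hσ2 : σ ^ 2 = (d : ℝ) - 3 := Real.sq_sqrt (by linarith)
  have hVc : Continuous ΨInf := hΨInfC.continuous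
  have hO42 : (fun t : ℝ => Real.exp (4 * t)) =O[atBot] fun t : ℝ => Real.exp (2 * t) := by
    apply IsBigO.of_bound 1
    filter_upwards [eventually_le_atBot 0] with t ht
    rw [Real.norm_eq_abs, Real.norm_eq_abs, Real.abs_exp, Real.abs_exp, one_mul]
    exact Real.exp_le_exp.mpr (by linarith)
  have hO : (fun t : ℝ => ΨInf t - σ) =O[atBot] fun t : ℝ => Real.exp (2 * t) := by
    have h1 : (fun t : ℝ => σ * lamInf * (4 * (d : ℝ) - 10)⁻¹ * Real.exp (2 * t)) =O[atBot]
        fun t : ℝ => Real.exp (2 * t) := (isBigO_refl _ _).const_mul_left _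
    refine ((hΨInfAsym.trans hO42).sub h1).congr_left fun t => ?_
    ring
  obtain ⟨K0, hK0, hVb⟩ := aux_bdd _ (by fun_prop) hO
  have hσ0 : 0 ≤ σ := Real.sqrt_nonneg _
  obtain ⟨Kv, hKv⟩ : ∃ Kv, Kv = K0 + σ := ⟨_, rfl⟩
  have hKv0 : 0 ≤ Kv := by rw [hKv]; positivity
  have hV1 : ∀ t ≤ 0, |ΨInf t| ≤ Kv := by
    intro t ht
    have h1 := hVb t ht
    have h2 : Real.exp (2 * t) ≤ 1 := Real.exp_le_one_iff.mpr (by linarith)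
    have h3 : |ΨInf t| ≤ |ΨInf t - σ| + |σ| := by
      simpa using abs_add_le (ΨInf t - σ) σ
    rw [abs_of_nonneg hσ0] at h3
    nlinarith
  have hV2 : ∀ t ≤ 0, |(d : ℝ) - 3 - ΨInf t ^ 2| ≤ 2 * Kv * K0 * Real.exp (2 * t) := by
    intro t ht
    have h1 := hVb t ht
    have h2 : (d : ℝ) - 3 - ΨInf t ^ 2 = -((ΨInf t + σ) * (ΨInf t - σ)) := by
      rw [← hσ2]; ring
    have h3 : |ΨInf t + σ| ≤ 2 * Kv := by
      have := hV1 t ht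
      refine (abs_add_le _ _).trans ?_
      rw [abs_of_nonneg hσ0]; linarith
    rw [h2, abs_neg, abs_mul]
    calc |ΨInf t + σ| * |ΨInf t - σ| ≤ (2 * Kv) * (K0 * Real.exp (2 * t)) := by gcongr
      _ = _ := by ring
  -- constants
  obtain ⟨r, hr, hrU⟩ := Metric.mem_nhds_iff.mp hU
  obtain ⟨K, hK⟩ : ∃ K, K = 4 * Kv + |lamInf| + 3 + 6 * Kv * K0 := ⟨_, rfl⟩
  obtain ⟨A, hA⟩ : ∃ A, A = 2 * (1 - km) * C₁ + 1 := ⟨_, rfl⟩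
  have hK1 : 1 ≤ K := by
    have : 0 ≤ |lamInf| := abs_nonneg _
    have : 0 ≤ Kv * K0 := by positivity
    rw [hK]; linarith
  have hA1 : 1 ≤ A := by
    have : 0 ≤ (1 - km) * C₁ := mul_nonneg (by linarith) hC₁.le
    rw [hA]; linarith
  obtain ⟨Q, hQ⟩ : ∃ Q, Q = 16 * K * A * Real.exp (4 * K + 1) := ⟨_, rfl⟩
  have hQ0 : 0 < Q := by rw [hQ]; positivity
  refine ⟨1, one_pos, 2 * A * Real.exp (4 * K + 1), by positivity,
    min (min 1 r) (1 / Q), by positivity, ?_⟩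
  intro ε hε b hb lam c hlc t ht
  obtain ⟨hε0, hε1⟩ := hε
  have hε11 : ε < 1 := hε1.trans_le ((min_le_left _ _).trans (min_le_left _ _))
  have hεr : ε < r := hε1.trans_le ((min_le_left _ _).trans (min_le_right _ _))
  have hεQ : Q * ε ≤ 1 := by
    have := (hε1.trans_le (min_le_right _ _)).le
    rw [le_div_iff₀ hQ0] at this; linarith
  have hb0 : 0 < b := by linarith
  obtain ⟨η, hη⟩ : ∃ η, η = ε * b ^ (km * (1 - a)) := ⟨_, rfl⟩
  have hη0 : 0 < η := by rw [hη]; positivity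
  have hbp : b ^ (km * (1 - a)) ≤ 1 :=
    Real.rpow_le_one_of_one_le_of_nonpos hb.le (by nlinarith)
  have hηε : η ≤ ε := by rw [hη]; nlinarith
  rw [← hη] at hlc
  have hl1 : |lam - lamInf| ≤ η := by linarith [abs_nonneg (c - cInf)]
  have hc1 : |c - cInf| ≤ η := by linarith [abs_nonneg (lam - lamInf)]
  have hmem : ((lam, c) : ℝ × ℝ) ∈ U := by
    apply hrU
    rw [Metric.mem_ball, Prod.dist_eq, Real.dist_eq, Real.dist_eq]
    exact max_lt (by simp only; linarith) (by simp only; linarith)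
  obtain ⟨hC, hEq, hInit⟩ := hfam _ hmem
  simp only at hC hEq hInit
  generalize Ψ lam c = P at *
  have hder : ∀ f : ℝ → ℝ, ContDiff ℝ 2 f → (∀ t, HasDerivAt f (deriv f t) t) ∧
      (∀ t, HasDerivAt (deriv f) (deriv (deriv f) t) t) := by
    intro f hf
    refine ⟨fun t => (hf.differentiable (by norm_num) t).hasDerivAt, fun t => ?_⟩
    have h1 : ContDiff ℝ 1 (deriv f) := by
      have : ContDiff ℝ (1 + 1) f := by simpa [one_add_one_eq_two] using hf
      exact (contDiff_succ_iff_deriv.mp this).2.2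
    exact (h1.differentiable (by norm_num) t).hasDerivAt
  obtain ⟨hP1, hP2⟩ := hder P hC
  obtain ⟨hV1d, hV2d⟩ := hder ΨInf hΨInfC
  have hcore := aux_core km kp K A η ε ((1 - a) * Real.log b)
    (fun t => P t - ΨInf t) (fun t => deriv P t - deriv ΨInf t)
    (fun t => -(lam - lamInf) * Real.exp (2 * t) * ΨInf t
      - lam * Real.exp (2 * t) * (P t - ΨInf t) + Real.exp (4 * t) * (P t - ΨInf t)
      + 3 * ((d : ℝ) - 3 - ΨInf t ^ 2) * (P t - ΨInf t)
      - 3 * ΨInf t * (P t - ΨInf t) ^ 2 - (P t - ΨInf t) ^ 3)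
    hkm1 hkpm hK1 hA1 hη0 (fun t => (hP1 t).sub (hV1d t)) ?_ ?_ ?_ (by rw [← hQ]; exact hεQ) ?_
  · have := hcore (-t) ⟨by linarith [ht.2], by nlinarith [ht.1]⟩
    simp only [neg_neg] at this
    rw [mul_assoc _ ε, ← hη]
    convert this using 3
    ring
  · intro t
    refine ((hP2 t).sub (hV2d t)).congr_deriv ?_
    simp only [hsum, hprod]
    linear_combination hEq t - hΨInfEq t
  · intro t ht
    have h1 := hV1 t ht
    have h2 := hV2 t ht
    have h3 : Real.exp (4 * t) ≤ Real.exp (2 * t) := Real.exp_le_exp.mpr (by linarith)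
    have hl2 : |lam| ≤ |lamInf| + 1 := by
      have : |lam| ≤ |lam - lamInf| + |lamInf| := by
        simpa using abs_add_le (lam - lamInf) lamInf
      linarith
    have he := Real.exp_pos (2 * t)
    have he4 := Real.exp_pos (4 * t)
    generalize P t - ΨInf t = x at *
    generalize ΨInf t = v at *
    generalize Real.exp (2 * t) = e at *
    generalize Real.exp (4 * t) = e4 at *
    have b1 : |-(lam - lamInf) * e * v| ≤ Kv * (e * η) := by
      rw [abs_mul, abs_mul, abs_neg, abs_of_pos he]
      calc |lam - lamInf| * e * |v| ≤ η * e * Kv := by gcongr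
        _ = _ := by ring
    have b2 : |lam * e * x| ≤ (|lamInf| + 1) * (e * |x|) := by
      rw [abs_mul, abs_mul, abs_of_pos he, mul_assoc]
      gcongr
    have b3 : |e4 * x| ≤ e * |x| := by
      rw [abs_mul, abs_of_pos he4]
      gcongr
    have b4 : |3 * ((d : ℝ) - 3 - v ^ 2) * x| ≤ 6 * Kv * K0 * (e * |x|) := by
      rw [abs_mul, abs_mul, abs_of_pos (by norm_num : (0 : ℝ) < 3)]
      calc 3 * |(d : ℝ) - 3 - v ^ 2| * |x| ≤ 3 * (2 * Kv * K0 * e) * |x| := by gcongr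
        _ = _ := by ring
    have b5 : |3 * v * x ^ 2| ≤ 3 * Kv * |x| ^ 2 := by
      rw [abs_mul, abs_mul, abs_of_pos (by norm_num : (0 : ℝ) < 3), abs_pow]
      gcongr
    have b6 : |x ^ 3| = |x| ^ 3 := abs_pow _ _
    have hx : 0 ≤ |x| := abs_nonneg x
    have htri : |-(lam - lamInf) * e * v - lam * e * x + e4 * x
        + 3 * ((d : ℝ) - 3 - v ^ 2) * x - 3 * v * x ^ 2 - x ^ 3|
        ≤ |-(lam - lamInf) * e * v| + |lam * e * x| + |e4 * x|
        + |3 * ((d : ℝ) - 3 - v ^ 2) * x| + |3 * v * x ^ 2| + |x ^ 3| := by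
      refine (abs_sub _ _).trans (add_le_add ?_ le_rfl)
      refine (abs_sub _ _).trans (add_le_add ?_ le_rfl)
      refine (abs_add_le _ _).trans (add_le_add ?_ le_rfl)
      refine (abs_add_le _ _).trans (add_le_add ?_ le_rfl)
      exact abs_sub _ _
    generalize |x| = y at *
    have hl0 : 0 ≤ |lamInf| := abs_nonneg _
    have hKK : 0 ≤ 6 * Kv * K0 := by positivity
    have c1 : Kv * (e * η) ≤ K * (e * η) := by
      apply mul_le_mul_of_nonneg_right _ (by positivity); rw [hK]; linarith
    have c2 : (|lamInf| + 1 + 1 + 6 * Kv * K0) * (e * y) ≤ K * (e * y) := by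
      apply mul_le_mul_of_nonneg_right _ (by positivity); rw [hK]; linarith
    have c3 : 3 * Kv * y ^ 2 ≤ K * y ^ 2 := by
      apply mul_le_mul_of_nonneg_right _ (by positivity); rw [hK]; linarith
    have c4 : 1 * y ^ 3 ≤ K * y ^ 3 := by
      apply mul_le_mul_of_nonneg_right hK1 (by positivity)
    linarith
  · have hi : |P 0 - ΨInf 0| + |deriv P 0 - deriv ΨInf 0| ≤ C₁ * η :=
      hInit.trans (by gcongr)
    generalize P 0 - ΨInf 0 = x at *
    generalize deriv P 0 - deriv ΨInf 0 = y at *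
    have hx : |x| ≤ C₁ * η := by linarith [abs_nonneg y]
    have hy : |y| ≤ C₁ * η := by linarith [abs_nonneg x]
    have gen : ∀ k, km ≤ k → k ≤ 0 → (y - k * x) ^ 2 ≤ ((1 - km) * (C₁ * η)) ^ 2 := by
      intro k hk1 hk2
      apply sq_le_sq'
      all_goals
        have h1 : |k * x| ≤ (-km) * (C₁ * η) := by
          rw [abs_mul, abs_of_nonpos hk2]
          gcongr
          linarith
        have := abs_le.mp h1
        have := abs_le.mp hy
        nlinarith
    have g1 := gen kp (by linarith) hkp0
    have g2 := gen km le_rfl (by linarith)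
    have h3 : (2 * ((1 - km) * (C₁ * η))) ^ 2 ≤ (η * A) ^ 2 := by
      have h5 : 0 ≤ (1 - km) * (C₁ * η) := mul_nonneg (by linarith) (by positivity)
      apply pow_le_pow_left₀ (by linarith)
      rw [hA]; nlinarith
    nlinarith [sq_nonneg ((1 - km) * (C₁ * η))]
  · rw [hη, Real.rpow_def_of_pos hb0, mul_assoc, ← Real.exp_add]
    apply le_of_eq
    rw [show Real.log b * (km * (1 - a)) + -km * ((1 - a) * Real.log b) = 0 by ring]
    simp
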